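/- arXiv:1310.7716 — 3 statements merged into one kernel-verified Lean document; each statement's English description precedes it below -/
import Mathlib

section
/- (Tate's local functional equation in r variables.) Let r ≥ 1, let Φ : ℝ^r → ℂ be a Schwartz function, and let Φ̂(t) = ∫_{ℝ^r} Φ(u) e(u·t) du be its inverse Fourier transform. Let χ : {1,…,r} → {0,1} and let s ∈ ℂ^r satisfy 0 < Re s_ν < 1 for every ν. Then (Γ_χ(s))^{−1} ∫_{(ℝ^×)^r} Φ(t) |t|_χ^s d^×t = i_χ^{−1} (Γ_χ(1−s))^{−1} ∫_{(ℝ^×)^r} Φ̂(t) |t|_χ^{1−s} d^×t, where d^×t = ∏_{ν=1}^r |t_ν|^{−1} dt_ν and both integrals converge absolutely. -/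
open MeasureTheory

noncomputable section

/-- `e z = exp (2 π i z)` -/
def eC (z : ℂ) : ℂ := Complex.exp (2 * Real.pi * Complex.I * z)

/-- `φ(t,x,y) = e(itx)/(1 - e(y + it))` -/
def phiF (t x y : ℝ) : ℂ := eC (Complex.I * t * x) / (1 - eC (y + Complex.I * t))

/-- `F(t,x,y) = ∏_ν φ(t_ν, x_ν, y_ν)` -/
def FF {r : ℕ} (t x y : Fin r → ℝ) : ℂ := ∏ ν, phiF (t ν) (x ν) (y ν)

/-- `Γ_ℝ(s) = π^(-s/2) Γ(s/2)` -/
def GammaR (s : ℂ) : ℂ := (Real.pi : ℂ) ^ (-s / 2) * Complex.Gamma (s / 2)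

/-- `Γ_ℂ(s) = 2 (2π)^(-s) Γ(s)` -/
def GammaC (s : ℂ) : ℂ := 2 * (2 * (Real.pi : ℂ)) ^ (-s) * Complex.Gamma s

/-- the quasi-character `|t|_χ^s = ∏_ν sgn(t_ν)^{χ(ν)} |t_ν|^{s_ν}` -/
def qchar {r : ℕ} (χ : Fin r → ℕ) (s : Fin r → ℂ) (t : Fin r → ℝ) : ℂ :=
  ∏ ν, ((Real.sign (t ν) : ℂ)) ^ (χ ν) * ((|t ν| : ℝ) : ℂ) ^ (s ν)

/-- the Shintani L-function, defined by the integral representation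
`L(s,A,x,y) = 2^r (∏ Γ_ℂ(s_ν))⁻¹ ∫_{(0,∞)^r} F(tA,x,y) t^s ∏ dt_ν/t_ν` -/
def ShintaniL {r : ℕ} (s : Fin r → ℂ) (A : Matrix (Fin r) (Fin r) ℝ)
    (x y : Fin r → ℝ) : ℂ :=
  2 ^ r * (∏ ν, GammaC (s ν))⁻¹ *
    ∫ t in Set.univ.pi fun _ : Fin r => Set.Ioi (0 : ℝ),
      FF (Matrix.vecMul t A) x y * ∏ ν, (((t ν : ℝ) : ℂ) ^ (s ν) * ((t ν : ℝ) : ℂ)⁻¹)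

/-- the normalized Shintani L-function of parity type χ,
`L_χ(s,A,x,y) = (∏ Γ_ℂ(s_ν))⁻¹ ∫_{(ℝ^×)^r} F(tA,x,y) |t|_χ^s ∏ dt_ν/t_ν` -/
def ShintaniLchi {r : ℕ} (χ : Fin r → ℕ) (s : Fin r → ℂ)
    (A : Matrix (Fin r) (Fin r) ℝ) (x y : Fin r → ℝ) : ℂ :=
  (∏ ν, GammaC (s ν))⁻¹ *
    ∫ t : Fin r → ℝ,
      FF (Matrix.vecMul t A) x y * qchar χ s t * ∏ ν, ((t ν : ℝ) : ℂ)⁻¹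

/-- `Γ_χ(s) = ∏_ν Γ_ℝ(s_ν + χ(ν))` -/
def GammaChi {r : ℕ} (χ : Fin r → ℕ) (s : Fin r → ℂ) : ℂ :=
  ∏ ν, GammaR (s ν + (χ ν : ℂ))

/-- the completed normalized Shintani L-function
`L̂_χ(s,A,x,y) = |det A|^{1/2} Γ_χ(s) L_χ(s,A,x,y)` -/
def ShintaniLhat {r : ℕ} (χ : Fin r → ℕ) (s : Fin r → ℂ)
    (A : Matrix (Fin r) (Fin r) ℝ) (x y : Fin r → ℝ) : ℂ :=
  ((Real.sqrt |A.det| : ℝ) : ℂ) * GammaChi χ s * ShintaniLchi χ s A x y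


open Complex Set

def kap (n : ℕ) (s : ℂ) (t : ℝ) : ℂ :=
  (Real.sign t : ℂ) ^ n * ((|t| : ℝ) : ℂ) ^ s * ((|t| : ℝ) : ℂ)⁻¹

def hK (n : ℕ) (s : ℂ) (t x : ℝ) : ℂ :=
  (x : ℂ) ^ ((s + n) / 2 - 1) * ((t : ℂ) ^ n * cexp (-((Real.pi * t ^ 2 : ℝ) * x)))

def kK (n : ℕ) (s : ℂ) (u x : ℝ) : ℂ :=
  (|(-1 : ℝ)| * x ^ ((-1 : ℝ) - 1)) • hK n (1 - s) u (x ^ (-1 : ℝ))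

lemma pos_cpow {a : ℝ} (ha : 0 < a) (z : ℂ) : (a : ℂ) ^ z = cexp ((Real.log a : ℂ) * z) := by
  rw [Complex.cpow_def_of_ne_zero (by exact_mod_cast ha.ne'), Complex.ofReal_log ha.le]

lemma norm_kap {n : ℕ} {s : ℂ} {t : ℝ} (ht : t ≠ 0) : ‖kap n s t‖ = |t| ^ (s.re - 1) := by
  have h : 0 < |t| := abs_pos.mpr ht
  have h1 : ‖(Real.sign t : ℂ)‖ = 1 := by
    rcases Real.sign_apply_eq_of_ne_zero t ht with h | h <;> simp [h]
  rw [kap, norm_mul, norm_mul, norm_pow, h1, Complex.norm_cpow_eq_rpow_re_of_pos h, norm_inv,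
    Real.rpow_sub h]
  simp [div_eq_mul_inv]

lemma hK_integral {n : ℕ} {s : ℂ} {t : ℝ} (hs : 0 < s.re) (ht : t ≠ 0) :
    ∫ x in Ioi (0:ℝ), hK n s t x = GammaR (s + n) * kap n (1 - s) t := by
  have h : 0 < |t| := abs_pos.mpr ht
  have hp : 0 < Real.pi * t ^ 2 := by positivity
  have hre : 0 < ((s + n) / 2).re := by
    have : ((s + n) / 2).re = (s.re + n) / 2 := by simp
    rw [this]; positivity
  have e : ∀ x : ℝ, hK n s t x = (t : ℂ) ^ n *
      ((x : ℂ) ^ ((s + n) / 2 - 1) * cexp (-((Real.pi * t ^ 2 : ℝ) * x))) := by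
    intro x; rw [hK]; ring
  simp_rw [e]
  rw [integral_const_mul, Complex.integral_cpow_mul_exp_neg_mul_Ioi hre hp]
  have e2 : (1 / ((Real.pi * t ^ 2 : ℝ) : ℂ)) = ((1 / (Real.pi * t ^ 2) : ℝ) : ℂ) := by push_cast; rfl
  rw [e2, kap, GammaR, pos_cpow (by positivity), pos_cpow h, pos_cpow Real.pi_pos]
  have e3 : Real.log (1 / (Real.pi * t ^ 2)) = - Real.log Real.pi - 2 * Real.log |t| := by
    rw [one_div, Real.log_inv, Real.log_mul Real.pi_ne_zero (by positivity), Real.log_pow,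
      Real.log_abs]
    push_cast; ring
  have e4 : (t : ℂ) = (Real.sign t : ℂ) * cexp (Real.log |t| : ℝ) := by
    rw [← Complex.ofReal_exp, Real.exp_log h, ← Complex.ofReal_mul]
    congr 1
    rcases lt_or_gt_of_ne ht with h' | h'
    · rw [Real.sign_of_neg h', abs_of_neg h']; ring
    · rw [Real.sign_of_pos h', abs_of_pos h']; ring
  have e5 : ((|t| : ℝ) : ℂ)⁻¹ = cexp (-(Real.log |t| : ℝ)) := by
    rw [Complex.exp_neg, ← Complex.ofReal_exp, Real.exp_log h]
  have e6 : (t : ℂ) ^ n = (Real.sign t : ℂ) ^ n * cexp (n * (Real.log |t| : ℝ)) := by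
    rw [Complex.exp_nat_mul, ← mul_pow, ← e4]
  rw [e3, e5, e6]
  have : cexp (n * (Real.log |t| : ℝ)) *
        cexp (((-Real.log Real.pi - 2 * Real.log |t| : ℝ) : ℂ) * ((s + n) / 2)) =
      cexp ((Real.log Real.pi : ℂ) * (-(s + n) / 2)) * (cexp ((Real.log |t| : ℂ) * (1 - s)) *
        cexp (-(Real.log |t| : ℝ))) := by
    rw [← Complex.exp_add, ← Complex.exp_add, ← Complex.exp_add]
    congr 1
    push_cast; ring
  linear_combination ((Real.sign t : ℂ) ^ n * Complex.Gamma ((s + n) / 2)) * this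

lemma hK_norm {n : ℕ} {s : ℂ} {t x : ℝ} (hx : 0 < x) :
    ((‖hK n s t x‖ : ℝ) : ℂ) = hK n s.re |t| x := by
  rw [hK, hK, norm_mul, norm_mul, norm_pow, Complex.norm_cpow_eq_rpow_re_of_pos hx,
    Complex.norm_exp]
  have : ((s + n) / 2 - 1).re = (s.re + n) / 2 - 1 := by simp
  rw [this]
  push_cast
  rw [Complex.ofReal_cpow hx.le, Complex.norm_real]
  have e2 : ((|t|:ℝ):ℂ)^2 = (t:ℂ)^2 := by exact_mod_cast congrArg (fun z : ℝ => (z:ℂ)) (sq_abs t)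
  simp only [Real.norm_eq_abs]
  rw [e2]
  have e3 : (-((Real.pi : ℂ) * t ^ 2 * x)).re = (-(Real.pi * t ^ 2 * x)) := by
    rw [← Complex.ofReal_re (-(Real.pi * t ^ 2 * x))]; push_cast; rfl
  rw [e3]
  push_cast; rfl

lemma hK_integrable {n : ℕ} {s : ℂ} {t : ℝ} (hs : 0 < s.re) (ht : t ≠ 0) :
    IntegrableOn (hK n s t) (Ioi (0:ℝ)) := by
  have hp : 0 < Real.pi * t ^ 2 := by positivity
  have hre : 0 < ((s + n) / 2).re := by
    have : ((s + n) / 2).re = (s.re + n) / 2 := by simp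
    rw [this]; positivity
  have := Complex.GammaIntegral_convergent hre
  rw [← mul_zero (Real.pi * t ^ 2), ← integrableOn_Ioi_comp_mul_left_iff _ _ hp] at this
  refine IntegrableOn.congr_fun (this.const_mul
    ((t:ℂ)^n * (((Real.pi * t ^ 2 : ℝ) : ℂ) ^ ((s + n) / 2 - 1))⁻¹)) ?_ measurableSet_Ioi
  intro x hx
  have hx : 0 < x := hx
  have hne : (((Real.pi * t ^ 2 : ℝ) : ℂ) ^ ((s + n) / 2 - 1)) ≠ 0 := by
    rw [pos_cpow hp]; exact Complex.exp_ne_zero _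
  simp only [hK]
  rw [Complex.ofReal_mul (Real.pi * t ^ 2) x, Complex.mul_cpow_ofReal_nonneg hp.le hx.le]
  push_cast at hne ⊢
  generalize ((Real.pi : ℂ) * (t : ℂ) ^ 2) ^ ((s + n) / 2 - 1) = A at hne ⊢
  field_simp

lemma hK_norm_integral {n : ℕ} {s : ℂ} {t : ℝ} (hs : 0 < s.re) (ht : t ≠ 0) :
    ∫ x in Ioi (0:ℝ), ‖hK n s t x‖ = ‖GammaR (s.re + n)‖ * |t| ^ (-s.re) := by
  have h : 0 < |t| := abs_pos.mpr ht
  have h1 : ((∫ x in Ioi (0:ℝ), ‖hK n s t x‖ : ℝ) : ℂ) = ∫ x in Ioi (0:ℝ), hK n s.re |t| x := by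
    rw [← integral_complex_ofReal]
    exact setIntegral_congr_fun measurableSet_Ioi fun x hx => hK_norm hx
  rw [hK_integral (by simpa using hs) h.ne'] at h1
  have h2 := congrArg norm h1
  rw [Complex.norm_real, Real.norm_of_nonneg (integral_nonneg fun _ => norm_nonneg _), norm_mul,
    norm_kap h.ne'] at h2
  rw [h2]; simp

lemma kK_integral {n : ℕ} {s : ℂ} {t : ℝ} (hs : s.re < 1) (ht : t ≠ 0) :
    ∫ x in Ioi (0:ℝ), kK n s t x = GammaR (1 - s + n) * kap n s t := by
  have := hK_integral (n := n) (s := 1 - s) (by simpa using hs) ht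
  simp only [kK]
  rw [integral_comp_rpow_Ioi (fun x => hK n (1 - s) t x) (by norm_num), this]
  simp

lemma kK_integrable {n : ℕ} {s : ℂ} {t : ℝ} (hs : s.re < 1) (ht : t ≠ 0) :
    IntegrableOn (kK n s t) (Ioi (0:ℝ)) := by
  have := hK_integrable (n := n) (s := 1 - s) (by simpa using hs) ht
  exact (integrableOn_Ioi_comp_rpow_iff _ (by norm_num)).2 this

lemma kK_norm_integral {n : ℕ} {s : ℂ} {t : ℝ} (hs : s.re < 1) (ht : t ≠ 0) :
    ∫ x in Ioi (0:ℝ), ‖kK n s t x‖ = ‖GammaR ((1 - s).re + n)‖ * |t| ^ (s.re - 1) := by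
  have := hK_norm_integral (n := n) (s := 1 - s) (by simpa using hs) ht
  have h2 := integral_comp_rpow_Ioi (fun x => ‖hK n (1 - s) t x‖) (p := -1) (by norm_num)
  rw [this] at h2
  have e : -(1 - s).re = s.re - 1 := by simp
  rw [← e, ← h2]
  refine setIntegral_congr_fun measurableSet_Ioi fun x hx => ?_
  have hx : 0 < x := hx
  simp only [kK, norm_smul]
  rw [Real.norm_of_nonneg (by positivity), smul_eq_mul]

lemma hK_meas (n : ℕ) (s : ℂ) : Measurable (fun p : ℝ × ℝ => hK n s p.1 p.2) := by
  unfold hK; fun_prop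

lemma kK_meas (n : ℕ) (s : ℂ) : Measurable (fun p : ℝ × ℝ => kK n s p.1 p.2) := by
  unfold kK hK; fun_prop

lemma ae_ne_zero (r : ℕ) : ∀ᵐ t : Fin r → ℝ, ∀ ν, t ν ≠ 0 := by
  rw [ae_all_iff]
  intro ν
  have h : ∀ᵐ x : ℝ, x ≠ 0 := by simp [ae_iff]
  exact (Measure.tendsto_eval_ae_ae (μ := fun _ : Fin r => (volume : Measure ℝ)) (i := ν)).eventually h

lemma fub {r : ℕ} {Ψ : (Fin r → ℝ) → ℂ} (hΨ : Continuous Ψ) (h : Fin r → ℝ → ℝ → ℂ)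
    (hm : ∀ ν, Measurable (fun p : ℝ × ℝ => h ν p.1 p.2))
    (hi : ∀ ν t, t ≠ 0 → IntegrableOn (h ν t) (Ioi (0:ℝ)))
    (C a : Fin r → ℝ)
    (hN : ∀ ν t, t ≠ 0 → ∫ x in Ioi (0:ℝ), ‖h ν t x‖ = C ν * |t| ^ (a ν))
    (hΨint : Integrable (fun t : Fin r → ℝ => ‖Ψ t‖ * ∏ ν, |t ν| ^ (a ν))) :
    ∫ t, Ψ t * ∏ ν, ∫ x in Ioi (0:ℝ), h ν (t ν) x =
      ∫ x in univ.pi fun _ : Fin r => Ioi (0:ℝ), ∫ t, Ψ t * ∏ ν, h ν (t ν) (x ν) := by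
  have hres : (volume : Measure (Fin r → ℝ)).restrict (univ.pi fun _ : Fin r => Ioi (0:ℝ)) =
      Measure.pi (fun _ => (volume : Measure ℝ).restrict (Ioi (0:ℝ))) :=
    Measure.restrict_pi_pi (fun _ : Fin r => (volume : Measure ℝ)) _
  rw [hres]
  have key : Integrable (Function.uncurry fun (t x : Fin r → ℝ) => Ψ t * ∏ ν, h ν (t ν) (x ν))
      ((volume : Measure (Fin r → ℝ)).prod
        (Measure.pi (fun _ => (volume : Measure ℝ).restrict (Ioi (0:ℝ))))) := by
    rw [integrable_prod_iff]
    · constructor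
      · filter_upwards [ae_ne_zero r] with t ht
        simp only [Function.uncurry]
        exact (Integrable.fintype_prod (f := fun ν => h ν (t ν)) fun ν => hi ν _ (ht ν)).const_mul _
      · refine (hΨint.const_mul (∏ ν, C ν)).congr ?_
        filter_upwards [ae_ne_zero r] with t ht
        simp only [Function.uncurry, norm_mul, norm_prod]
        rw [integral_const_mul, integral_fintype_prod_eq_prod (fun ν x => ‖h ν (t ν) x‖)]
        rw [Finset.prod_congr rfl fun ν _ => hN ν (t ν) (ht ν), Finset.prod_mul_distrib]
        ring
    · apply Measurable.aestronglyMeasurable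
      refine Measurable.mul (hΨ.measurable.comp measurable_fst) ?_
      refine Finset.measurable_prod _ fun ν _ => ?_
      have hg : Measurable (fun q : (Fin r → ℝ) × (Fin r → ℝ) => (q.1 ν, q.2 ν)) := by fun_prop
      exact (hm ν).comp hg
  rw [← integral_integral_swap key]
  congr 1
  ext t
  rw [integral_const_mul, integral_fintype_prod_eq_prod (fun ν x => h ν (t ν) x)]

lemma one_dim_int {a : ℝ} (ha : -1 < a) (ha0 : a < 0) :
    Integrable (fun t : ℝ => (1 + t ^ 2)⁻¹ * |t| ^ a) := by
  have h1 : IntegrableOn (fun t : ℝ => |t| ^ a) (Icc (-1) 1) := by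
    have hp : IntegrableOn (fun t : ℝ => |t| ^ a) (Icc 0 1) := by
      have := (intervalIntegral.intervalIntegrable_rpow' (a := 0) (b := 1) ha)
      rw [intervalIntegrable_iff_integrableOn_Icc_of_le zero_le_one] at this
      refine this.congr_fun (fun x hx => ?_) measurableSet_Icc
      simp only [abs_of_nonneg hx.1]
    have hn : IntegrableOn (fun t : ℝ => |t| ^ a) (Icc (-1) 0) := by
      rw [← (Measure.measurePreserving_neg (volume : Measure ℝ)).integrableOn_comp_preimage
        (Homeomorph.neg ℝ).measurableEmbedding]
      simpa [Function.comp_def] using hp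
    have := hn.union hp
    rwa [Icc_union_Icc_eq_Icc (by norm_num) (by norm_num)] at this
  have h2 := (integrable_indicator_iff measurableSet_Icc).2 h1
  refine (h2.add integrable_inv_one_add_sq).mono' ?_ ?_
  · apply Measurable.aestronglyMeasurable; fun_prop
  · refine ae_of_all _ fun t => ?_
    have e0 : 0 ≤ |t| ^ a := by positivity
    have e1 : (0:ℝ) ≤ (1 + t ^ 2)⁻¹ := by positivity
    have e2 : (1 + t ^ 2)⁻¹ ≤ 1 := inv_le_one_of_one_le₀ (by nlinarith [sq_nonneg t])
    rw [Real.norm_of_nonneg (by positivity)]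
    simp only [Pi.add_apply, indicator]
    split_ifs with h
    · nlinarith
    · have : 1 ≤ |t| := by
        by_contra hc
        push Not at hc
        exact h (abs_le.1 hc.le)
      have : |t| ^ a ≤ 1 := Real.rpow_le_one_of_one_le_of_nonpos this ha0.le
      nlinarith

lemma schwartz_int {r : ℕ} (Φ : SchwartzMap (Fin r → ℝ) ℂ) (a : Fin r → ℝ)
    (ha : ∀ ν, -1 < a ν ∧ a ν < 0) :
    Integrable (fun t : Fin r → ℝ => ‖Φ t‖ * ∏ ν, |t ν| ^ (a ν)) := by
  have hb := fun t => SchwartzMap.one_add_le_sup_seminorm_apply (𝕜 := ℝ) (m := (2 * r, 0))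
    (k := 2 * r) (n := 0) le_rfl le_rfl Φ t
  set C := 2 ^ (2 * r, 0).1 * (Finset.Iic (2 * r, 0)).sup
    (fun m => SchwartzMap.seminorm ℝ m.1 m.2) Φ with hC
  clear_value C
  have hg := (Integrable.fintype_prod (μ := fun _ : Fin r => (volume : Measure ℝ))
    (f := fun ν t => (1 + t ^ 2)⁻¹ * |t| ^ (a ν))
    fun ν => one_dim_int (ha ν).1 (ha ν).2).const_mul C
  refine Integrable.mono' hg ?_ ?_
  · apply Measurable.aestronglyMeasurable
    have := Φ.continuous.measurable
    fun_prop
  · refine ae_of_all _ fun t => ?_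
    have hP : 0 ≤ ∏ ν, |t ν| ^ (a ν) := Finset.prod_nonneg fun _ _ => by positivity
    have hQ : 0 < ∏ ν, (1 + t ν ^ 2) := Finset.prod_pos fun _ _ => by positivity
    rw [Real.norm_of_nonneg (by positivity), Finset.prod_mul_distrib, ← mul_assoc,
      Finset.prod_inv_distrib]
    refine mul_le_mul_of_nonneg_right ?_ hP
    rw [← div_eq_mul_inv, le_div_iff₀ hQ]
    have h1 := hb t
    rw [norm_iteratedFDeriv_zero] at h1
    have h2 : ∏ ν, (1 + t ν ^ 2) ≤ (1 + ‖t‖) ^ (2 * r) := by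
      calc _ ≤ ∏ ν : Fin r, (1 + ‖t‖) ^ 2 := by
            refine Finset.prod_le_prod (fun _ _ => by positivity) fun ν _ => ?_
            have h3 := norm_le_pi_norm t ν
            rw [Real.norm_eq_abs] at h3
            rw [← sq_abs (t ν)]
            nlinarith [abs_nonneg (t ν), norm_nonneg t]
        _ = _ := by simp [pow_mul]
    nlinarith [norm_nonneg (Φ t)]

lemma exists_fourier {r : ℕ} (Φ : SchwartzMap (Fin r → ℝ) ℂ) :
    ∃ Ψ : SchwartzMap (Fin r → ℝ) ℂ, ∀ t, Ψ t =
      ∫ u : Fin r → ℝ, Φ u * eC ((∑ ν, u ν * t ν : ℝ) : ℂ) := by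
  let e : EuclideanSpace ℝ (Fin r) ≃L[ℝ] (Fin r → ℝ) := EuclideanSpace.equiv (Fin r) ℝ
  let Φ' : SchwartzMap (EuclideanSpace ℝ (Fin r)) ℂ :=
    SchwartzMap.compCLMOfContinuousLinearEquiv ℂ e Φ
  let Ψ' : SchwartzMap (EuclideanSpace ℝ (Fin r)) ℂ := FourierTransformInv.fourierInv Φ'
  refine ⟨SchwartzMap.compCLMOfContinuousLinearEquiv ℂ e.symm Ψ', fun t => ?_⟩
  have h1 : SchwartzMap.compCLMOfContinuousLinearEquiv ℂ e.symm Ψ' t = Ψ' (e.symm t) := rfl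
  rw [h1]
  simp only [Ψ']
  rw [SchwartzMap.fourierInv_coe, Real.fourierInv_eq',
    ← (PiLp.volume_preserving_toLp (Fin r)).integral_comp
      (MeasurableEquiv.toLp 2 (Fin r → ℝ)).measurableEmbedding]
  congr 1
  ext u
  have h2 : Φ' (WithLp.toLp 2 u) = Φ u := rfl
  rw [h2, smul_eq_mul, mul_comm, eC]
  congr 2
  have h3 : inner ℝ (WithLp.toLp 2 u) (e.symm t) = ∑ ν, u ν * t ν := by
    rw [PiLp.inner_apply]
    refine Finset.sum_congr rfl fun ν _ => ?_
    have : (e.symm t) ν = t ν := rfl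
    rw [this]
    simp [mul_comm]
  rw [h3]
  push_cast; ring

lemma norm_eC_real (x : ℝ) : ‖eC (x : ℂ)‖ = 1 := by
  rw [eC, Complex.norm_exp]
  simp

lemma gauss0 {x : ℝ} (hx : 0 < x) (u : ℝ) :
    ∫ t : ℝ, cexp (-((Real.pi * t ^ 2 : ℝ) * x)) * eC ((u * t : ℝ) : ℂ) =
      (x : ℂ) ^ (-(1 / 2) : ℂ) * cexp (-((Real.pi * u ^ 2 : ℝ) * (x⁻¹ : ℝ))) := by
  have hb : 0 < ((Real.pi * x : ℝ) : ℂ).re := by rw [Complex.ofReal_re]; positivity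
  have h := fourierIntegral_gaussian hb (2 * Real.pi * u)
  have hx' : (x : ℂ) ≠ 0 := by exact_mod_cast hx.ne'
  have hpi : (Real.pi : ℂ) ≠ 0 := by exact_mod_cast Real.pi_ne_zero
  have e1 : (Real.pi : ℂ) / ((Real.pi * x : ℝ) : ℂ) = ((x⁻¹ : ℝ) : ℂ) := by
    push_cast; field_simp
  rw [e1, pos_cpow (inv_pos.2 hx), Real.log_inv] at h
  rw [pos_cpow hx]
  calc _ = _ := by
        congr 1; ext t
        rw [eC, ← Complex.exp_add]
        rw [show cexp (-((Real.pi * t ^ 2 : ℝ) * x) + 2 * Real.pi * I * ((u * t : ℝ) : ℂ)) =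
          cexp (I * (2 * Real.pi * u) * t) * cexp (-((Real.pi * x : ℝ) : ℂ) * t ^ 2) from ?_]
        rw [← Complex.exp_add]; congr 1; push_cast; ring
    _ = _ := h
    _ = _ := by
        congr 2
        · push_cast; ring
        · push_cast; field_simp; ring

lemma gauss_int0 {x : ℝ} (hx : 0 < x) :
    Integrable (fun t : ℝ => cexp (-((Real.pi * t ^ 2 : ℝ) * x))) := by
  have hb : 0 < ((Real.pi * x : ℝ) : ℂ).re := by rw [Complex.ofReal_re]; positivity
  refine (integrable_cexp_neg_mul_sq hb).congr (ae_of_all _ fun t => ?_)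
  simp only
  congr 1; push_cast; ring

lemma gauss_int1 {x : ℝ} (hx : 0 < x) :
    Integrable (fun t : ℝ => (t : ℂ) * cexp (-((Real.pi * t ^ 2 : ℝ) * x))) := by
  have hb : 0 < ((Real.pi * x : ℝ) : ℂ).re := by rw [Complex.ofReal_re]; positivity
  refine (integrable_mul_cexp_neg_mul_sq hb).congr (ae_of_all _ fun t => ?_)
  simp only
  congr 2; push_cast; ring

lemma mul_eC_int {f : ℝ → ℂ} (hf : Integrable f) (u : ℝ) :
    Integrable (fun t : ℝ => f t * eC ((u * t : ℝ) : ℂ)) := by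
  refine hf.mul_bdd (c := 1) ?_ (ae_of_all _ fun t => (norm_eC_real _).le)
  apply Measurable.aestronglyMeasurable
  unfold eC; fun_prop

lemma gauss1 {x : ℝ} (hx : 0 < x) (u : ℝ) :
    ∫ t : ℝ, ((t : ℂ) * cexp (-((Real.pi * t ^ 2 : ℝ) * x))) * eC ((u * t : ℝ) : ℂ) =
      I * u * (x : ℂ)⁻¹ * ((x : ℂ) ^ (-(1 / 2) : ℂ) *
        cexp (-((Real.pi * u ^ 2 : ℝ) * (x⁻¹ : ℝ)))) := by
  have hx' : (x : ℂ) ≠ 0 := by exact_mod_cast hx.ne'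
  have hpi : (Real.pi : ℂ) ≠ 0 := by exact_mod_cast Real.pi_ne_zero
  have i0 := mul_eC_int (gauss_int0 hx) u
  have i1 := mul_eC_int (gauss_int1 hx) u
  have hd : ∀ t : ℝ, HasDerivAt
      (fun t : ℝ => cexp (-((Real.pi * t ^ 2 : ℝ) * x)) * eC ((u * t : ℝ) : ℂ))
      ((-2 * Real.pi * x) * ((t : ℂ) * cexp (-((Real.pi * t ^ 2 : ℝ) * x)) * eC ((u * t : ℝ) : ℂ))
       + (2 * Real.pi * I * u) * (cexp (-((Real.pi * t ^ 2 : ℝ) * x)) * eC ((u * t : ℝ) : ℂ))) t := by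
    intro t
    have h1 : HasDerivAt (fun z : ℂ => cexp (-(Real.pi * z ^ 2 * x) + 2 * Real.pi * I * (u * z)))
        (cexp (-(Real.pi * (t:ℂ) ^ 2 * x) + 2 * Real.pi * I * (u * t)) *
          (-(Real.pi * (2 * t) * x) + 2 * Real.pi * I * u)) (t : ℂ) := by
      apply HasDerivAt.cexp
      have a1 : HasDerivAt (fun z : ℂ => z ^ 2) (2 * t) (t : ℂ) := by
        simpa using hasDerivAt_pow 2 (t : ℂ)
      have a2 := ((a1.const_mul (Real.pi : ℂ)).mul_const (x : ℂ)).neg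
      have a3 := ((hasDerivAt_id (t : ℂ)).const_mul (u : ℂ)).const_mul (2 * Real.pi * I)
      have a4 := a2.add a3
      rw [mul_one] at a4
      exact a4
    have h2 := h1.comp_ofReal
    convert! h2 using 1
    · ext y
      rw [eC, ← Complex.exp_add]; push_cast; rfl
    · rw [eC, mul_assoc (t : ℂ), ← Complex.exp_add]; push_cast; ring
  have h0 := integral_eq_zero_of_hasDerivAt_of_integrable hd
    ((i1.const_mul _).add (i0.const_mul _)) i0
  rw [integral_add (i1.const_mul _) (i0.const_mul _), integral_const_mul, integral_const_mul,
    gauss0 hx] at h0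
  have h3 : (2 * (Real.pi : ℂ) * x) ≠ 0 := by simp [hx', hpi]
  apply mul_left_cancel₀ h3
  generalize (x : ℂ) ^ (-(1 / 2) : ℂ) * cexp (-((Real.pi * u ^ 2 : ℝ) * (x⁻¹ : ℝ))) = G at h0 ⊢
  have h4 : 2 * (Real.pi : ℂ) * x * (I * u * (x : ℂ)⁻¹ * G) = 2 * Real.pi * I * u * G := by
    field_simp
  rw [h4]
  linear_combination -h0

lemma hK_int_t {n : ℕ} (hn : n ≤ 1) (s : ℂ) {x : ℝ} (hx : 0 < x) :
    Integrable (fun t : ℝ => hK n s t x) := by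
  unfold hK
  apply Integrable.const_mul
  interval_cases n
  · simpa using gauss_int0 hx
  · simpa using gauss_int1 hx

lemma hK_fourier {n : ℕ} (hn : n ≤ 1) (s : ℂ) {x : ℝ} (hx : 0 < x) (u : ℝ) :
    ∫ t : ℝ, hK n s t x * eC ((u * t : ℝ) : ℂ) = I ^ n * kK n s u x := by
  have e : ∀ t : ℝ, hK n s t x * eC ((u * t : ℝ) : ℂ) = (x : ℂ) ^ ((s + n) / 2 - 1) *
      (((t : ℂ) ^ n * cexp (-((Real.pi * t ^ 2 : ℝ) * x))) * eC ((u * t : ℝ) : ℂ)) := by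
    intro t; rw [hK]; ring
  simp_rw [e]
  rw [integral_const_mul, kK, hK, Real.rpow_neg_one, pos_cpow hx, pos_cpow (inv_pos.2 hx),
    Real.log_inv, Complex.real_smul]
  have e2 : ((|(-1:ℝ)| * x ^ ((-1:ℝ) - 1) : ℝ) : ℂ) = cexp (Real.log x * (-2)) := by
    rw [abs_neg, abs_one, one_mul, Complex.ofReal_cpow hx.le, pos_cpow hx]; norm_num
  have e3 : (x : ℂ)⁻¹ = cexp (Real.log x * (-1)) := by
    rw [mul_neg_one, Complex.exp_neg, ← Complex.ofReal_exp, Real.exp_log hx]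
  rw [e2]
  interval_cases n
  · have := gauss0 hx u
    simp only [pow_zero, one_mul]
    rw [this, pos_cpow hx]
    simp only [← Complex.exp_add]
    congr 1
    push_cast; ring
  · have := gauss1 hx u
    simp only [pow_one]
    rw [this, pos_cpow hx, e3]
    have : cexp (Real.log x * ((s + (1:ℕ)) / 2 - 1)) * (cexp (Real.log x * (-1)) *
        cexp (Real.log x * (-(1/2)))) = cexp (Real.log x * (-2)) *
        cexp (((-Real.log x : ℝ) : ℂ) * ((1 - s + (1:ℕ)) / 2 - 1)) := by
      rw [← Complex.exp_add, ← Complex.exp_add, ← Complex.exp_add]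
      congr 1; push_cast; ring
    linear_combination (I * u * cexp (-((Real.pi * u ^ 2 : ℝ) * (x⁻¹ : ℝ)))) * this

lemma inner_swap {r : ℕ} (Φ : SchwartzMap (Fin r → ℝ) ℂ) (χ : Fin r → ℕ) (hχ : ∀ ν, χ ν ≤ 1)
    (s : Fin r → ℂ) (x : Fin r → ℝ) (hx : ∀ ν, 0 < x ν) :
    ∫ t : Fin r → ℝ, (∫ u : Fin r → ℝ, Φ u * eC ((∑ ν, u ν * t ν : ℝ) : ℂ)) *
        ∏ ν, hK (χ ν) (s ν) (t ν) (x ν) =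
      I ^ (∑ ν, χ ν) * ∫ u : Fin r → ℝ, Φ u * ∏ ν, kK (χ ν) (s ν) (u ν) (x ν) := by
  have hG : Integrable (fun t : Fin r → ℝ => ∏ ν, hK (χ ν) (s ν) (t ν) (x ν)) :=
    Integrable.fintype_prod (μ := fun _ : Fin r => (volume : Measure ℝ))
      (f := fun ν t => hK (χ ν) (s ν) t (x ν)) fun ν => hK_int_t (hχ ν) _ (hx ν)
  have hΦ : Integrable (fun u : Fin r → ℝ => Φ u) := Φ.integrable
  have key : Integrable (Function.uncurry fun (t u : Fin r → ℝ) =>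
      Φ u * eC ((∑ ν, u ν * t ν : ℝ) : ℂ) * ∏ ν, hK (χ ν) (s ν) (t ν) (x ν))
      ((volume : Measure (Fin r → ℝ)).prod volume) := by
    have h1 := (hG.mul_prod hΦ).mul_bdd (c := 1)
      (g := fun q : (Fin r → ℝ) × (Fin r → ℝ) => eC ((∑ ν, q.2 ν * q.1 ν : ℝ) : ℂ)) ?_
      (ae_of_all _ fun q => (norm_eC_real _).le)
    · refine h1.congr (ae_of_all _ fun q => ?_)
      simp only [Function.uncurry]; ring
    · apply Measurable.aestronglyMeasurable
      unfold eC; fun_prop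
  simp_rw [← integral_mul_const]
  rw [integral_integral_swap key, ← integral_const_mul]
  congr 1
  ext u
  have h2 : ∀ t : Fin r → ℝ, Φ u * eC ((∑ ν, u ν * t ν : ℝ) : ℂ) *
      ∏ ν, hK (χ ν) (s ν) (t ν) (x ν) =
      Φ u * ∏ ν, (hK (χ ν) (s ν) (t ν) (x ν) * eC ((u ν * t ν : ℝ) : ℂ)) := by
    intro t
    have : eC ((∑ ν, u ν * t ν : ℝ) : ℂ) = ∏ ν, eC ((u ν * t ν : ℝ) : ℂ) := by
      simp only [eC]
      rw [← Complex.exp_sum, Complex.ofReal_sum, Finset.mul_sum]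
    rw [this, Finset.prod_mul_distrib]; ring
  simp_rw [h2]
  rw [integral_const_mul,
    integral_fintype_prod_volume_eq_prod
      (fun ν t => hK (χ ν) (s ν) t (x ν) * eC ((u ν * t : ℝ) : ℂ)),
    Finset.prod_congr rfl fun ν _ => hK_fourier (hχ ν) (s ν) (hx ν) (u ν),
    Finset.prod_mul_distrib, Finset.prod_pow_eq_pow_sum]
  ring

lemma GammaR_ne {z : ℂ} (hz : 0 < z.re) : GammaR z ≠ 0 := by
  rw [GammaR, pos_cpow Real.pi_pos]
  refine mul_ne_zero (Complex.exp_ne_zero _) (Complex.Gamma_ne_zero_of_re_pos ?_)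
  have : (z / 2).re = z.re / 2 := by simp
  rw [this]; linarith

lemma qchar_kap {r : ℕ} (χ : Fin r → ℕ) (s : Fin r → ℂ) (t : Fin r → ℝ) (c : ℂ) :
    c * qchar χ s t * ∏ ν, ((|t ν| : ℝ) : ℂ)⁻¹ = c * ∏ ν, kap (χ ν) (s ν) (t ν) := by
  simp only [qchar, kap]
  rw [mul_assoc, ← Finset.prod_mul_distrib]

lemma main_int {r : ℕ} (Φ : SchwartzMap (Fin r → ℝ) ℂ) (χ : Fin r → ℕ) (s : Fin r → ℂ)
    (hs : ∀ ν, 0 < (s ν).re ∧ (s ν).re < 1) :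
    Integrable (fun t : Fin r → ℝ => Φ t * ∏ ν, kap (χ ν) (s ν) (t ν)) := by
  refine (schwartz_int Φ (fun ν => (s ν).re - 1)
    (fun ν => ⟨by linarith [(hs ν).1], by linarith [(hs ν).2]⟩)).mono' ?_ ?_
  · apply Measurable.aestronglyMeasurable
    have := Φ.continuous.measurable
    have hsg : Measurable Real.sign := by
      unfold Real.sign
      exact Measurable.ite measurableSet_Iio measurable_const
        (Measurable.ite measurableSet_Ioi measurable_const measurable_const)
    unfold kap
    fun_prop
  · filter_upwards [ae_ne_zero r] with t ht
    rw [norm_mul, norm_prod, Finset.prod_congr rfl fun ν _ => norm_kap (ht ν)]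

lemma main_eq {r : ℕ} (Φ : SchwartzMap (Fin r → ℝ) ℂ)
    (χ : Fin r → ℕ) (hχ : ∀ ν, χ ν ≤ 1) (s : Fin r → ℂ)
    (hs : ∀ ν, 0 < (s ν).re ∧ (s ν).re < 1) (Ψ : SchwartzMap (Fin r → ℝ) ℂ)
    (hΨ : ∀ t, Ψ t = ∫ u : Fin r → ℝ, Φ u * eC ((∑ ν, u ν * t ν : ℝ) : ℂ)) :
    GammaChi χ s * ∫ t : Fin r → ℝ, Ψ t * ∏ ν, kap (χ ν) (1 - s ν) (t ν) =
      I ^ (∑ ν, χ ν) * (GammaChi χ (fun ν => 1 - s ν) *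
        ∫ t : Fin r → ℝ, Φ t * ∏ ν, kap (χ ν) (s ν) (t ν)) := by
  have f1 := fub Ψ.continuous (fun ν => hK (χ ν) (s ν)) (fun ν => hK_meas _ _)
    (fun ν t ht => hK_integrable (hs ν).1 ht) _ (fun ν => -(s ν).re)
    (fun ν t ht => hK_norm_integral (hs ν).1 ht)
    (schwartz_int Ψ _ fun ν => ⟨by linarith [(hs ν).2], by linarith [(hs ν).1]⟩)
  have f2 := fub Φ.continuous (fun ν => kK (χ ν) (s ν)) (fun ν => kK_meas _ _)
    (fun ν t ht => kK_integrable (hs ν).2 ht) _ (fun ν => (s ν).re - 1)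
    (fun ν t ht => kK_norm_integral (hs ν).2 ht)
    (schwartz_int Φ _ fun ν => ⟨by linarith [(hs ν).1], by linarith [(hs ν).2]⟩)
  have g1 : ∫ t, Ψ t * ∏ ν, ∫ x in Ioi (0:ℝ), hK (χ ν) (s ν) (t ν) x =
      GammaChi χ s * ∫ t : Fin r → ℝ, Ψ t * ∏ ν, kap (χ ν) (1 - s ν) (t ν) := by
    rw [← integral_const_mul]
    refine integral_congr_ae ?_
    filter_upwards [ae_ne_zero r] with t ht
    rw [Finset.prod_congr rfl fun ν _ => hK_integral (hs ν).1 (ht ν), Finset.prod_mul_distrib,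
      GammaChi]
    ring
  have g2 : ∫ t, Φ t * ∏ ν, ∫ x in Ioi (0:ℝ), kK (χ ν) (s ν) (t ν) x =
      GammaChi χ (fun ν => 1 - s ν) * ∫ t : Fin r → ℝ, Φ t * ∏ ν, kap (χ ν) (s ν) (t ν) := by
    rw [← integral_const_mul]
    refine integral_congr_ae ?_
    filter_upwards [ae_ne_zero r] with t ht
    rw [Finset.prod_congr rfl fun ν _ => kK_integral (hs ν).2 (ht ν), Finset.prod_mul_distrib,
      GammaChi]
    ring
  rw [← g1, ← g2, f1, f2, ← integral_const_mul]
  refine setIntegral_congr_fun (MeasurableSet.univ_pi fun _ => measurableSet_Ioi) fun x hx => ?_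
  simp only [hΨ]
  exact inner_swap Φ χ hχ s x fun ν => hx ν (mem_univ ν)

theorem stmt_8 (r : ℕ) (hr : 1 ≤ r) (Φ : SchwartzMap (Fin r → ℝ) ℂ)
    (χ : Fin r → ℕ) (hχ : ∀ ν, χ ν ≤ 1) (s : Fin r → ℂ)
    (hs : ∀ ν, 0 < (s ν).re ∧ (s ν).re < 1) :
    MeasureTheory.Integrable
      (fun t : Fin r → ℝ => Φ t * qchar χ s t * ∏ ν, ((|t ν| : ℝ) : ℂ)⁻¹) ∧
    MeasureTheory.Integrable
      (fun t : Fin r → ℝ =>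
        (∫ u : Fin r → ℝ, Φ u * eC ((∑ ν, u ν * t ν : ℝ) : ℂ)) *
          qchar χ (fun ν => 1 - s ν) t * ∏ ν, ((|t ν| : ℝ) : ℂ)⁻¹) ∧
    (GammaChi χ s)⁻¹ *
        ∫ t : Fin r → ℝ, Φ t * qchar χ s t * ∏ ν, ((|t ν| : ℝ) : ℂ)⁻¹ =
      (Complex.I ^ (∑ ν, χ ν))⁻¹ * (GammaChi χ (fun ν => 1 - s ν))⁻¹ *
        ∫ t : Fin r → ℝ,
          (∫ u : Fin r → ℝ, Φ u * eC ((∑ ν, u ν * t ν : ℝ) : ℂ)) *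
            qchar χ (fun ν => 1 - s ν) t * ∏ ν, ((|t ν| : ℝ) : ℂ)⁻¹ := by
  obtain ⟨Ψ, hΨ⟩ := exists_fourier Φ
  have hs' : ∀ ν, 0 < (1 - s ν).re ∧ (1 - s ν).re < 1 := fun ν => by
    simp only [Complex.sub_re, Complex.one_re]
    exact ⟨by linarith [(hs ν).2], by linarith [(hs ν).1]⟩
  simp_rw [← hΨ, qchar_kap]
  refine ⟨main_int Φ χ s hs, main_int Ψ χ _ hs', ?_⟩
  have h := main_eq Φ χ hχ s hs Ψ hΨ
  have n1 : GammaChi χ s ≠ 0 := Finset.prod_ne_zero_iff.2 fun ν _ => GammaR_ne (by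
    simp only [Complex.add_re, Complex.natCast_re]
    have := (hs ν).1
    positivity)
  have n2 : GammaChi χ (fun ν => 1 - s ν) ≠ 0 := Finset.prod_ne_zero_iff.2 fun ν _ => GammaR_ne (by
    have := (hs' ν).1
    rw [Complex.add_re, Complex.natCast_re]
    positivity)
  have n3 : Complex.I ^ (∑ ν, χ ν) ≠ 0 := pow_ne_zero _ Complex.I_ne_zero
  generalize (∫ t : Fin r → ℝ, Φ t * ∏ ν, kap (χ ν) (s ν) (t ν)) = A at h ⊢
  generalize (∫ t : Fin r → ℝ, Ψ t * ∏ ν, kap (χ ν) (1 - s ν) (t ν)) = B at h ⊢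
  field_simp
  linear_combination -h


end
end

section
/- Let r = 1, χ : {1} → {0,1}, A ∈ ℝ^×, x, y ∈ (0,1), and s ∈ ℂ with Re s > 1. Then L_χ(s, A, x, y) = (sgn(A)/2) Σ_{m ∈ ℤ} e(my) / |A(x+m)|_χ^s, where |u|_χ^s = sgn(u)^{χ(1)} |u|^s for u ∈ ℝ^×, and the bilateral series converges absolutely. -/
open MeasureTheory

noncomputable section

/-- the normalized Shintani L-function of degree 1:
`L_χ(s,A,x,y) = Γ_ℂ(s)⁻¹ ∫_{ℝ^×} φ(tA,x,y) |t|_χ^s dt/t` -/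
def ShintaniLchi1 (χ : ℕ) (s : ℂ) (A x y : ℝ) : ℂ :=
  (GammaC s)⁻¹ *
    ∫ t : ℝ, phiF (t * A) x y *
      (((Real.sign t : ℝ) : ℂ) ^ χ * ((|t| : ℝ) : ℂ) ^ s) * ((t : ℝ) : ℂ)⁻¹

lemma aux_eC_norm (a b : ℝ) : ‖eC (a + Complex.I * b)‖ = Real.exp (-(2 * Real.pi * b)) := by
  rw [eC, Complex.norm_exp]
  congr 1
  simp

lemma aux_eC_real_norm (a : ℝ) : ‖eC (a : ℂ)‖ = 1 := by
  have := aux_eC_norm a 0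
  simpa using this

lemma aux_eC_add (a b : ℂ) : eC (a + b) = eC a * eC b := by
  rw [eC, eC, eC, ← Complex.exp_add]; ring_nf

lemma aux_eC_ne (a : ℂ) : eC a ≠ 0 := Complex.exp_ne_zero _

lemma aux_eC_one : eC 1 = 1 := by
  rw [eC, mul_one, Complex.exp_two_pi_mul_I]

lemma aux_norm_lt {t : ℝ} (y : ℝ) (ht : 0 < t) : ‖eC (y + Complex.I * t)‖ < 1 := by
  rw [aux_eC_norm, Real.exp_lt_one_iff]
  have := mul_pos Real.two_pi_pos ht
  linarith

/-- geometric expansion -/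
lemma aux_hasSum (x y c t : ℝ) (hc : 0 < c) (ht : 0 < t) :
    HasSum (fun n : ℕ => eC (((n : ℝ) * y : ℝ) : ℂ) *
      (Real.exp (-(2 * Real.pi * (c * (x + n))) * t) : ℂ)) (phiF (t * c) x y) := by
  have h := (hasSum_geometric_of_norm_lt_one (aux_norm_lt y (mul_pos ht hc))).mul_left
    (eC (Complex.I * ((t * c : ℝ) : ℂ) * x))
  rw [phiF, div_eq_mul_inv]
  refine h.congr_fun fun n => ?_
  simp only [eC]
  rw [Complex.ofReal_exp, ← Complex.exp_nat_mul, ← Complex.exp_add, ← Complex.exp_add]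
  congr 1
  push_cast
  linear_combination (-2 * (Real.pi : ℂ) * c * t * (x + n)) * Complex.I_sq

lemma aux_phi_le (x y t : ℝ) (ht : 0 < t) : ‖phiF t x y‖ ≤ ‖phiF t x 0‖ := by
  have h0 := aux_norm_lt y ht
  have e0 : eC (((0 : ℝ) : ℂ) + Complex.I * t) = ((‖eC (y + Complex.I * t)‖ : ℝ) : ℂ) := by
    rw [aux_eC_norm, eC, Complex.ofReal_exp]
    congr 1
    push_cast
    linear_combination (2 * (Real.pi : ℂ) * t) * Complex.I_sq
  rw [phiF, phiF, norm_div, norm_div, e0]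
  have h1 : ‖(1 : ℂ) - ((‖eC (y + Complex.I * t)‖ : ℝ) : ℂ)‖ = 1 - ‖eC (y + Complex.I * t)‖ := by
    rw [← Complex.ofReal_one, ← Complex.ofReal_sub, Complex.norm_real, Real.norm_eq_abs,
      abs_of_pos (by linarith)]
  rw [h1]
  apply div_le_div_of_nonneg_left (norm_nonneg _) (by linarith)
  have := norm_sub_norm_le (1 : ℂ) (eC (y + Complex.I * t))
  simpa using this

lemma aux_meas (x y c : ℝ) : Measurable fun t : ℝ => phiF (t * c) x y := by
  unfold phiF eC
  fun_prop

lemma aux_mellin (x y c : ℝ) (hx : 0 < x) (hc : 0 < c) (s : ℂ) (hs : 1 < s.re) :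
    HasSum (fun n : ℕ => Complex.Gamma s * eC (((n : ℝ) * y : ℝ) : ℂ) /
      ((2 * Real.pi * (c * (x + n)) : ℝ) : ℂ) ^ s)
      (mellin (fun t : ℝ => phiF (t * c) x y) s) := by
  have hp (n : ℕ) : 0 < 2 * Real.pi * (c * (x + n)) := by positivity
  refine hasSum_mellin (fun n => Or.inr (hp n)) (by linarith)
    (fun t ht => aux_hasSum x y c t hc ht) ?_
  have h := ((Real.summable_one_div_nat_add_rpow x s.re).2 hs).mul_left
    (1 / (2 * Real.pi * c) ^ s.re)
  refine h.congr fun n => ?_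
  rw [aux_eC_real_norm, abs_of_pos (by positivity), div_mul_div_comm, one_mul,
    ← Real.mul_rpow (by positivity) (by positivity)]
  congr 2
  ring

lemma aux_int (x y c : ℝ) (hx : 0 < x) (hc : 0 < c) (s : ℂ) (hs : 1 < s.re) :
    IntegrableOn (fun t : ℝ => (t : ℂ) ^ (s - 1) * phiF (t * c) x y) (Set.Ioi 0) := by
  have hp (n : ℕ) : 0 < 2 * Real.pi * (c * (x + n)) := by positivity
  have h0 : mellin (fun t : ℝ => phiF (t * c) x 0) (s.re : ℂ) ≠ 0 := by
    have h := Complex.hasSum_re (aux_mellin x 0 c hx hc (s.re : ℂ) (by simpa using hs))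
    have hpos : ∀ n : ℕ, 0 < (Complex.Gamma (s.re : ℂ) * eC (((n : ℝ) * 0 : ℝ) : ℂ) /
      ((2 * Real.pi * (c * (x + n)) : ℝ) : ℂ) ^ (s.re : ℂ)).re := by
      intro n
      rw [← Complex.ofReal_cpow (hp n).le, Complex.Gamma_ofReal]
      have : eC (((n : ℝ) * 0 : ℝ) : ℂ) = 1 := by simp [eC]
      rw [this, mul_one, ← Complex.ofReal_div, Complex.ofReal_re]
      exact div_pos (Real.Gamma_pos_of_pos (by linarith)) (Real.rpow_pos_of_pos (hp n) _)
    intro h1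
    rw [h1] at h
    have h2 := h.summable.tsum_pos (fun n => (hpos n).le) 0 (hpos 0)
    rw [h.tsum_eq] at h2
    simp at h2
  have h1 := Integrable.of_integral_ne_zero h0
  refine Integrable.mono h1 ?_ ?_
  · refine AEStronglyMeasurable.mul ?_ (aux_meas x y c).aestronglyMeasurable
    exact Measurable.aestronglyMeasurable (by fun_prop)
  · refine (ae_restrict_iff' measurableSet_Ioi).2 (Filter.Eventually.of_forall fun t ht => ?_)
    have ht : 0 < t := ht
    rw [norm_mul, norm_smul, Complex.norm_cpow_eq_rpow_re_of_pos ht,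
      Complex.norm_cpow_eq_rpow_re_of_pos ht]
    simp only [Complex.sub_re, Complex.ofReal_re]
    exact mul_le_mul_of_nonneg_left (aux_phi_le x y _ (mul_pos ht hc)) (by positivity)

lemma aux_refl (x y t : ℝ) : phiF (-t) x y = -eC (-y) * phiF t (1 - x) (-y) := by
  have h1 : eC (y + Complex.I * ((-t : ℝ) : ℂ)) * eC (((-y : ℝ) : ℂ) + Complex.I * t) = 1 := by
    rw [← aux_eC_add, eC]
    have : (y : ℂ) + Complex.I * ((-t : ℝ) : ℂ) + (((-y : ℝ) : ℂ) + Complex.I * t) = 0 := by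
      push_cast; ring
    rw [this]; simp
  have h2 : eC (Complex.I * ((-t : ℝ) : ℂ) * x) * eC (((-y : ℝ) : ℂ) + Complex.I * t) =
      eC (-y) * eC (Complex.I * t * ((1 - x : ℝ) : ℂ)) := by
    rw [← aux_eC_add, ← aux_eC_add]; congr 1; push_cast; ring
  rw [phiF, phiF]
  have hne := aux_eC_ne (((-y : ℝ) : ℂ) + Complex.I * t)
  rw [← mul_div_mul_right _ _ hne, sub_mul, h1, h2, one_mul, ← neg_sub (1 : ℂ), div_neg,
    neg_mul, mul_div_assoc]

/-- the integrand -/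
def auxI (χ : ℕ) (s : ℂ) (A x y t : ℝ) : ℂ := phiF (t * A) x y *
      (((Real.sign t : ℝ) : ℂ) ^ χ * ((|t| : ℝ) : ℂ) ^ s) * ((t : ℝ) : ℂ)⁻¹

lemma auxI_pos (χ : ℕ) (s : ℂ) (A x y t : ℝ) (ht : 0 < t) :
    auxI χ s A x y t = (t : ℂ) ^ (s - 1) * phiF (t * A) x y := by
  have h : (t : ℂ) ≠ 0 := by exact_mod_cast ht.ne'
  rw [auxI, Real.sign_of_pos ht, abs_of_pos ht, Complex.cpow_sub _ _ h, Complex.cpow_one]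
  simp
  ring

lemma auxI_neg (χ : ℕ) (s : ℂ) (A x y t : ℝ) (ht : 0 < t) :
    auxI χ s A x y (-t) =
      ((-1) ^ χ * eC (-y)) * ((t : ℂ) ^ (s - 1) * phiF (t * A) (1 - x) (-y)) := by
  have h : (t : ℂ) ≠ 0 := by exact_mod_cast ht.ne'
  rw [auxI, Real.sign_of_neg (by linarith), abs_neg, abs_of_pos ht, Complex.cpow_sub _ _ h,
    Complex.cpow_one, neg_mul, aux_refl]
  push_cast
  rw [inv_neg]
  ring

/-- the summand -/
def auxT (χ : ℕ) (s : ℂ) (A x y : ℝ) (m : ℤ) : ℂ := eC (((m : ℝ) * y : ℝ) : ℂ) /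
        (((Real.sign (A * (x + m)) : ℝ) : ℂ) ^ χ * ((|A * (x + m)| : ℝ) : ℂ) ^ s)

lemma aux_main (χ : ℕ) (c : ℝ) (hc : 0 < c) (x y : ℝ)
    (hx : x ∈ Set.Ioo (0 : ℝ) 1) (s : ℂ) (hs : 1 < s.re) :
    HasSum (fun m : ℤ => Complex.Gamma s * (2 * (Real.pi : ℂ)) ^ (-s) * auxT χ s c x y m)
      (∫ t : ℝ, auxI χ s c x y t) := by
  obtain ⟨hx0, hx1⟩ := hx
  have hx1' : 0 < 1 - x := by linarith
  have ip : IntegrableOn (auxI χ s c x y) (Set.Ioi 0) :=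
    (aux_int x y c hx0 hc s hs).congr_fun
      (fun t ht => (auxI_pos χ s c x y t ht).symm) measurableSet_Ioi
  have iN : IntegrableOn (fun t => auxI χ s c x y (-t)) (Set.Ioi 0) :=
    IntegrableOn.congr_fun ((aux_int (1 - x) (-y) c hx1' hc s hs).const_mul _)
      (fun t ht => (auxI_neg χ s c x y t ht).symm) measurableSet_Ioi
  have iN' : IntegrableOn (auxI χ s c x y) (Set.Iic 0) := by
    rw [integrableOn_Iic_iff_integrableOn_Iio]
    have := (Measure.measurePreserving_neg (volume : Measure ℝ)).integrableOn_comp_preimage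
      (Homeomorph.neg ℝ).measurableEmbedding (f := auxI χ s c x y) (s := Set.Iio 0)
    refine this.1 ?_
    simpa [Function.comp_def] using iN
  have hsplit := intervalIntegral.integral_Iic_add_Ioi iN' ip
  have hneg := integral_comp_neg_Ioi 0 (auxI χ s c x y)
  rw [neg_zero] at hneg
  rw [← hsplit, ← hneg, setIntegral_congr_fun measurableSet_Ioi (auxI_neg χ s c x y),
    setIntegral_congr_fun measurableSet_Ioi (auxI_pos χ s c x y), integral_const_mul, add_comm]
  have key (q : ℝ) (hq : 0 < q) : ((2 * Real.pi * q : ℝ) : ℂ) ^ s =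
      (2 * (Real.pi : ℂ)) ^ s * (q : ℂ) ^ s := by
    rw [Complex.ofReal_mul, Complex.mul_cpow_ofReal_nonneg (by positivity) hq.le]
    push_cast; rfl
  apply HasSum.of_nat_of_neg_add_one
  · have hm := aux_mellin x y c hx0 hc s hs
    simp only [mellin, smul_eq_mul] at hm
    refine hm.congr_fun fun n => ?_
    have h : 0 < c * (x + n) := by positivity
    rw [key _ h, auxT]
    simp only [Int.cast_natCast]
    rw [Real.sign_of_pos h, abs_of_pos h, Complex.cpow_neg]
    simp
    field_simp
  · have hm := (aux_mellin (1 - x) (-y) c hx1' hc s hs).mul_left ((-1) ^ χ * eC (-y))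
    simp only [mellin, smul_eq_mul] at hm
    refine hm.congr_fun fun n => ?_
    have h : 0 < c * (1 - x + n) := by positivity
    have h' : c * (x + ((-((n : ℤ) + 1) : ℤ) : ℝ)) = -(c * (1 - x + n)) := by push_cast; ring
    rw [key _ h, auxT, h', Real.sign_of_neg (by linarith), abs_neg, abs_of_pos h, Complex.cpow_neg]
    have e : eC ((((-((n : ℤ) + 1) : ℤ) : ℝ) * y : ℝ) : ℂ) =
        eC (-y) * eC (((n : ℝ) * -y : ℝ) : ℂ) := by
      rw [← aux_eC_add]; congr 1; push_cast; ring
    have e1 : ((((-1 : ℝ) : ℂ)) ^ χ)⁻¹ = (-1) ^ χ := by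
      push_cast; rw [← inv_pow]; norm_num
    rw [e, div_eq_mul_inv, mul_inv, e1]
    field_simp

lemma aux_summable (χ : ℕ) (A : ℝ) (hA : A ≠ 0) (x y : ℝ)
    (hx : x ∈ Set.Ioo (0 : ℝ) 1) (s : ℂ) (hs : 1 < s.re) :
    Summable (fun m : ℤ => ‖auxT χ s A x y m‖) := by
  have h := ((Real.summable_one_div_int_add_rpow x s.re).2 hs).mul_left
    (1 / |A| ^ s.re)
  refine h.congr fun m => ?_
  have hne : x + m ≠ 0 := by
    intro h0
    have h1 : (0 : ℝ) < ((-m : ℤ) : ℝ) := by push_cast; linarith [hx.1]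
    have h2 : ((-m : ℤ) : ℝ) < ((1 : ℤ) : ℝ) := by push_cast; linarith [hx.2]
    rw [Int.cast_pos] at h1
    rw [Int.cast_lt] at h2
    omega
  have hAm : A * (x + m) ≠ 0 := mul_ne_zero hA hne
  have hsg : ‖((Real.sign (A * (x + m)) : ℝ) : ℂ)‖ = 1 := by
    rcases Real.sign_apply_eq_of_ne_zero _ hAm with h | h <;> rw [h] <;> simp
  rw [auxT, norm_div, norm_mul, norm_pow, hsg, aux_eC_real_norm,
    Complex.norm_cpow_eq_rpow_re_of_pos (abs_pos.2 hAm), abs_mul,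
    Real.mul_rpow (abs_nonneg _) (abs_nonneg _), one_pow, one_mul, div_mul_div_comm, one_mul,
    add_comm x]

lemma aux_final_pos (χ : ℕ) (A : ℝ) (hA : 0 < A) (x y : ℝ)
    (hx : x ∈ Set.Ioo (0 : ℝ) 1) (s : ℂ) (hs : 1 < s.re) :
    (GammaC s)⁻¹ * ∫ t : ℝ, auxI χ s A x y t = 1 / 2 * ∑' m : ℤ, auxT χ s A x y m := by
  rw [← (aux_main χ A hA x y hx s hs).tsum_eq, tsum_mul_left, GammaC]
  have h1 : Complex.Gamma s ≠ 0 := Complex.Gamma_ne_zero_of_re_pos (by linarith)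
  have h2 : (2 * (Real.pi : ℂ)) ^ (-s) ≠ 0 := by
    rw [Complex.cpow_ne_zero_iff]
    left
    exact_mod_cast Real.two_pi_pos.ne'
  field_simp

lemma aux_sign_neg (r : ℝ) : Real.sign (-r) = -Real.sign r := Real.sign_neg

lemma auxI_negA (χ : ℕ) (s : ℂ) (A x y t : ℝ) :
    auxI χ s A x y t = -(-1) ^ χ * auxI χ s (-A) x y (-t) := by
  have h : ((-1 : ℂ) ^ χ) * (-1) ^ χ = 1 := by rw [← mul_pow]; norm_num
  rw [auxI, auxI, Real.sign_neg, abs_neg, neg_mul_neg]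
  push_cast
  rw [neg_pow ((Real.sign t : ℝ) : ℂ), inv_neg]
  linear_combination (-(phiF (t * A) x y * (((Real.sign t : ℝ) : ℂ) ^ χ * ((|t| : ℝ) : ℂ) ^ s)
    * ((t : ℝ) : ℂ)⁻¹)) * h

lemma auxT_negA (χ : ℕ) (s : ℂ) (A x y : ℝ) (m : ℤ) :
    auxT χ s A x y m = (-1) ^ χ * auxT χ s (-A) x y m := by
  have e1 : ((((-1 : ℂ))) ^ χ)⁻¹ = (-1) ^ χ := by
    rw [← inv_pow]; norm_num
  have h : ((-1 : ℂ) ^ χ) * (-1) ^ χ = 1 := by rw [← mul_pow]; norm_num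
  rw [auxT, auxT, neg_mul, Real.sign_neg, abs_neg]
  push_cast
  rw [neg_pow ((Real.sign (A * (x + m)) : ℝ) : ℂ), mul_assoc, div_eq_mul_inv, div_eq_mul_inv,
    mul_inv ((-1) ^ χ), e1]
  linear_combination (-(eC ((m : ℂ) * y) * (((Real.sign (A * (x + m)) : ℝ) : ℂ) ^ χ *
    ((|A * (x + m)| : ℝ) : ℂ) ^ s)⁻¹)) * h

theorem stmt_10 (χ : ℕ) (hχ : χ ≤ 1) (A : ℝ) (hA : A ≠ 0) (x y : ℝ)
    (hx : x ∈ Set.Ioo (0 : ℝ) 1) (hy : y ∈ Set.Ioo (0 : ℝ) 1)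
    (s : ℂ) (hs : 1 < s.re) :
    Summable (fun m : ℤ =>
      ‖eC (((m : ℝ) * y : ℝ) : ℂ) /
        (((Real.sign (A * (x + m)) : ℝ) : ℂ) ^ χ * ((|A * (x + m)| : ℝ) : ℂ) ^ s)‖) ∧
    ShintaniLchi1 χ s A x y =
      ((Real.sign A : ℝ) : ℂ) / 2 *
        ∑' m : ℤ, eC (((m : ℝ) * y : ℝ) : ℂ) /
          (((Real.sign (A * (x + m)) : ℝ) : ℂ) ^ χ * ((|A * (x + m)| : ℝ) : ℂ) ^ s) := by
  refine ⟨aux_summable χ A hA x y hx s hs, ?_⟩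
  change (GammaC s)⁻¹ * ∫ t : ℝ, auxI χ s A x y t =
    ((Real.sign A : ℝ) : ℂ) / 2 * ∑' m : ℤ, auxT χ s A x y m
  rcases lt_or_gt_of_ne hA with h | h
  · have hp := aux_final_pos χ (-A) (by linarith) x y hx s hs
    rw [Real.sign_of_neg h]
    simp_rw [auxI_negA χ s A, auxT_negA χ s A]
    rw [integral_const_mul, tsum_mul_left, integral_neg_eq_self (auxI χ s (-A) x y) volume]
    push_cast
    linear_combination (-(-1) ^ χ) * hp
  · rw [Real.sign_of_pos h, aux_final_pos χ A h x y hx s hs]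
    simp

end
end

section
/- Let r ≥ 1, χ : {1,…,r} → {0,1}, and let f(s, A, x, y) be a complex-valued function defined for s ∈ ℂ^r with 0 < Re s_ν < 1 for every ν, A ∈ GL_r(ℝ), and x, y ∈ (ℝ∖ℤ)^r, satisfying: (i) f(s, A, x, y) = L_χ(s, A, x, y) whenever x, y ∈ (0,1)^r; (ii) f(s, A, x, y+k) = f(s, A, x, y) for all k ∈ ℤ^r; and (iii) |det A|^{1/2} Γ_χ(s) f(s, A, x, y) = i_χ e(−x·y) |det A|^{−1/2} Γ_χ(1−s) f(1−s, A*, y, 1−x) for all such s, A, x, y, where A* = (Aᵀ)^{−1}. Then f(s, A, x, y) = e(−[x]·y) L_χ(s, A, x−[x], y−[y]) for all such s, A, x, y, where [x] denotes the componentwise floor. -/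
open MeasureTheory

noncomputable section

theorem stmt_13 (r : ℕ) (hr : 1 ≤ r) (χ : Fin r → ℕ) (hχ : ∀ ν, χ ν ≤ 1)
    (f : (Fin r → ℂ) → Matrix (Fin r) (Fin r) ℝ → (Fin r → ℝ) → (Fin r → ℝ) → ℂ)
    (h1 : ∀ (s : Fin r → ℂ) (A : Matrix (Fin r) (Fin r) ℝ) (x y : Fin r → ℝ),
      (∀ ν, 0 < (s ν).re ∧ (s ν).re < 1) → A.det ≠ 0 →
      (∀ ν, x ν ∈ Set.Ioo (0 : ℝ) 1) → (∀ ν, y ν ∈ Set.Ioo (0 : ℝ) 1) →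
      f s A x y = ShintaniLchi χ s A x y)
    (h2 : ∀ (s : Fin r → ℂ) (A : Matrix (Fin r) (Fin r) ℝ) (x y : Fin r → ℝ),
      (∀ ν, 0 < (s ν).re ∧ (s ν).re < 1) → A.det ≠ 0 →
      (∀ ν, x ν ∉ Set.range ((↑) : ℤ → ℝ)) → (∀ ν, y ν ∉ Set.range ((↑) : ℤ → ℝ)) →
      ∀ k : Fin r → ℤ, f s A x (fun ν => y ν + (k ν : ℝ)) = f s A x y)
    (h3 : ∀ (s : Fin r → ℂ) (A : Matrix (Fin r) (Fin r) ℝ) (x y : Fin r → ℝ),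
      (∀ ν, 0 < (s ν).re ∧ (s ν).re < 1) → A.det ≠ 0 →
      (∀ ν, x ν ∉ Set.range ((↑) : ℤ → ℝ)) → (∀ ν, y ν ∉ Set.range ((↑) : ℤ → ℝ)) →
      ((Real.sqrt |A.det| : ℝ) : ℂ) * GammaChi χ s * f s A x y =
        Complex.I ^ (∑ ν, χ ν) * eC (-((∑ ν, x ν * y ν : ℝ) : ℂ)) *
          ((Real.sqrt |A.det| : ℝ) : ℂ)⁻¹ * GammaChi χ (fun ν => 1 - s ν) *
          f (fun ν => 1 - s ν) A.transpose⁻¹ y (fun ν => 1 - x ν))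
    (s : Fin r → ℂ) (A : Matrix (Fin r) (Fin r) ℝ) (x y : Fin r → ℝ)
    (hs : ∀ ν, 0 < (s ν).re ∧ (s ν).re < 1) (hA : A.det ≠ 0)
    (hx : ∀ ν, x ν ∉ Set.range ((↑) : ℤ → ℝ))
    (hy : ∀ ν, y ν ∉ Set.range ((↑) : ℤ → ℝ)) :
    f s A x y = eC (-((∑ ν, (⌊x ν⌋ : ℝ) * y ν : ℝ) : ℂ)) *
      ShintaniLchi χ s A (fun ν => Int.fract (x ν)) (fun ν => Int.fract (y ν)) := by
  have hC : ((Real.sqrt |A.det| : ℝ) : ℂ) * GammaChi χ s ≠ 0 := by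
    refine mul_ne_zero ?_ ?_
    · exact_mod_cast (Real.sqrt_pos.mpr (abs_pos.mpr hA)).ne'
    · unfold GammaChi
      refine Finset.prod_ne_zero_iff.mpr fun ν _ => ?_
      unfold GammaR
      refine mul_ne_zero ?_ ?_
      · rw [Complex.cpow_def_of_ne_zero (by exact_mod_cast Real.pi_ne_zero)]
        exact Complex.exp_ne_zero _
      · refine Complex.Gamma_ne_zero_of_re_pos ?_
        have h := (hs ν).1
        have h' : (0 : ℝ) ≤ (χ ν : ℝ) := Nat.cast_nonneg _
        have e : ((s ν + (χ ν : ℂ)) / 2).re = ((s ν).re + (χ ν : ℝ)) / 2 := by simp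
        rw [e]
        linarith
  have hs' : ∀ ν, 0 < (1 - s ν).re ∧ (1 - s ν).re < 1 := by
    intro ν
    have h := hs ν
    simp only [Complex.sub_re, Complex.one_re]
    constructor <;> linarith [h.1, h.2]
  have hA' : (A.transpose⁻¹).det ≠ 0 := by
    rw [Matrix.det_nonsing_inv, Matrix.det_transpose]
    simpa using hA
  have hpos : ∀ z : ℝ, z ∉ Set.range ((↑) : ℤ → ℝ) → Int.fract z ∈ Set.Ioo (0 : ℝ) 1 := by
    intro z hz
    refine ⟨lt_of_le_of_ne (Int.fract_nonneg z) fun h => hz ⟨⌊z⌋, ?_⟩, Int.fract_lt_one z⟩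
    have := Int.floor_add_fract z
    linarith
  have hint : ∀ z : ℝ, z ∈ Set.Ioo (0 : ℝ) 1 → z ∉ Set.range ((↑) : ℤ → ℝ) := by
    rintro z ⟨h0, h1⟩ ⟨n, rfl⟩
    have a : 0 < n := by exact_mod_cast h0
    have b : n < 1 := by exact_mod_cast h1
    omega
  have hxf : ∀ ν, Int.fract (x ν) ∈ Set.Ioo (0 : ℝ) 1 := fun ν => hpos _ (hx ν)
  have hyf : ∀ ν, Int.fract (y ν) ∈ Set.Ioo (0 : ℝ) 1 := fun ν => hpos _ (hy ν)
  have E1 := h3 s A x y hs hA hx hy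
  have E2 := h3 s A (fun ν => Int.fract (x ν)) y hs hA (fun ν => hint _ (hxf ν)) hy
  have P1 := h2 (fun ν => 1 - s ν) A.transpose⁻¹ y (fun ν => 1 - x ν) hs' hA' hy
    (fun ν => by
      rintro ⟨n, hn⟩
      refine hx ν ⟨1 - n, ?_⟩
      push_cast
      rw [hn]
      ring) (fun ν => ⌊x ν⌋)
  have e1 : (fun ν => 1 - x ν + ((⌊x ν⌋ : ℤ) : ℝ)) = fun ν => 1 - Int.fract (x ν) := by
    funext ν
    rw [← Int.self_sub_floor]
    ring
  rw [e1] at P1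
  have P2 := h2 s A (fun ν => Int.fract (x ν)) (fun ν => Int.fract (y ν)) hs hA
    (fun ν => hint _ (hxf ν)) (fun ν => hint _ (hyf ν)) (fun ν => ⌊y ν⌋)
  have e2 : (fun ν => Int.fract (y ν) + ((⌊y ν⌋ : ℤ) : ℝ)) = y := by
    funext ν
    exact Int.fract_add_floor _
  rw [e2] at P2
  have hE : eC (-((∑ ν, x ν * y ν : ℝ) : ℂ)) =
      eC (-((∑ ν, (⌊x ν⌋ : ℝ) * y ν : ℝ) : ℂ)) *
        eC (-((∑ ν, Int.fract (x ν) * y ν : ℝ) : ℂ)) := by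
    have : (∑ ν, x ν * y ν : ℝ) =
        (∑ ν, (⌊x ν⌋ : ℝ) * y ν) + ∑ ν, Int.fract (x ν) * y ν := by
      rw [← Finset.sum_add_distrib]
      refine Finset.sum_congr rfl fun ν _ => ?_
      rw [← add_mul, Int.floor_add_fract]
    rw [this]
    unfold eC
    rw [← Complex.exp_add]
    congr 1
    push_cast
    ring
  rw [P1] at E2
  rw [← h1 s A _ _ hs hA hxf hyf, ← P2]
  apply mul_left_cancel₀ hC
  rw [E1, hE]
  linear_combination (-eC (-((∑ ν, (⌊x ν⌋ : ℝ) * y ν : ℝ) : ℂ))) * E2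

end
end
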